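/- Let F : C → D be a linear monoidal functor between k-linear additive rigid monoidal categories such that (1) Hom_D(F(-), 1) is representable by Z ∈ C, (2) F is dominant (every object of D is a direct summand of some F(X)), and (3) C is idempotent complete. Then F has a right adjoint R with R(1) ≅ Z and a left adjoint L with L(1) ≅ Z^*. -/

import Mathlib

open CategoryTheory CategoryTheory.MonoidalCategory CategoryTheory.Limits

namespace AdjDominant

open Functor.LaxMonoidal Functor.OplaxMonoidal

universe v₁ v₂ u₁ u₂

section Rep

variable {C : Type u₁} {D : Type u₂} [Category.{v₁} C] [Category.{v₂} D]

/-- natural family of bijections `Hom(F X, Y) ≃ Hom(X, A)`. -/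
structure RRep (F : C ⥤ D) (Y : D) (A : C) where
  eqv : ∀ X : C, (F.obj X ⟶ Y) ≃ (X ⟶ A)
  nat : ∀ {X X' : C} (h : X ⟶ X') (u : F.obj X' ⟶ Y), eqv X (F.map h ≫ u) = h ≫ eqv X' u

/-- natural family of bijections `Hom(A, X) ≃ Hom(Y, F X)`. -/
structure LRep (F : C ⥤ D) (Y : D) (A : C) where
  eqv : ∀ X : C, (A ⟶ X) ≃ (Y ⟶ F.obj X)
  nat : ∀ {X X' : C} (h : X ⟶ X') (u : A ⟶ X), eqv X' (u ≫ h) = eqv X u ≫ F.map h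

variable {F : C ⥤ D}

lemma RRep.nat_symm {Y : D} {A : C} (a : RRep F Y A) {X X' : C} (h : X ⟶ X') (u : X' ⟶ A) :
    (a.eqv X).symm (h ≫ u) = F.map h ≫ (a.eqv X').symm u := by
  rw [Equiv.symm_apply_eq, a.nat, Equiv.apply_symm_apply]

lemma LRep.nat_symm {Y : D} {A : C} (a : LRep F Y A) {X X' : C} (h : X ⟶ X')
    (u : Y ⟶ F.obj X) :
    (a.eqv X').symm (u ≫ F.map h) = (a.eqv X).symm u ≫ h := by
  rw [Equiv.symm_apply_eq, a.nat, Equiv.apply_symm_apply]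

def RRep.iso {Y : D} {A B : C} (a : RRep F Y A) (b : RRep F Y B) : A ≅ B where
  hom := b.eqv A ((a.eqv A).symm (𝟙 A))
  inv := a.eqv B ((b.eqv B).symm (𝟙 B))
  hom_inv_id := by rw [← a.nat, ← b.nat_symm]; simp
  inv_hom_id := by rw [← b.nat, ← a.nat_symm]; simp

def LRep.iso {Y : D} {A B : C} (a : LRep F Y A) (b : LRep F Y B) : A ≅ B where
  hom := (a.eqv B).symm (b.eqv B (𝟙 B))
  inv := (b.eqv A).symm (a.eqv A (𝟙 A))
  hom_inv_id := by rw [← a.nat_symm, ← b.nat]; simp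
  inv_hom_id := by rw [← b.nat_symm, ← a.nat]; simp

lemma RRep.retract [IsIdempotentComplete C] {Y Y' : D} {A : C} (a : RRep F Y A)
    (s : Y' ⟶ Y) (r : Y ⟶ Y') (hsr : s ≫ r = 𝟙 Y') : ∃ B, Nonempty (RRep F Y' B) := by
  -- the idempotent on `A` induced by `r ≫ s`
  let q : A ⟶ A := a.eqv A ((a.eqv A).symm (𝟙 A) ≫ r ≫ s)
  have hq : ∀ {X : C} (g : X ⟶ A), g ≫ q = a.eqv X ((a.eqv X).symm g ≫ r ≫ s) := by
    intro X g
    dsimp only [q]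
    rw [← a.nat, ← Category.assoc, ← a.nat_symm, Category.comp_id]
  obtain ⟨B, i, p, hip, hpi⟩ := IsIdempotentComplete.idempotents_split A q (by
    rw [hq]; dsimp only [q]; simp [reassoc_of% hsr])
  have hiq : i ≫ q = i := by rw [← hpi, reassoc_of% hip]
  refine ⟨B, ⟨⟨fun X => ⟨fun f => a.eqv X (f ≫ s) ≫ p, fun g => (a.eqv X).symm (g ≫ i) ≫ r,
    ?_, ?_⟩, ?_⟩⟩⟩
  · intro f
    simp only [Category.assoc, hpi]
    rw [hq]
    simp [reassoc_of% hsr, hsr]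
  · intro g
    simp only [Category.assoc]
    rw [← reassoc_of% hq, Category.assoc, reassoc_of% hiq, hip, Category.comp_id]
  · intro X X' h u
    simp only [Equiv.coe_fn_mk, Category.assoc]
    rw [a.nat, Category.assoc]

lemma LRep.retract [IsIdempotentComplete C] {Y Y' : D} {A : C} (a : LRep F Y A)
    (s : Y' ⟶ Y) (r : Y ⟶ Y') (hsr : s ≫ r = 𝟙 Y') : ∃ B, Nonempty (LRep F Y' B) := by
  let q : A ⟶ A := (a.eqv A).symm (r ≫ s ≫ a.eqv A (𝟙 A))
  have hq : ∀ {X : C} (g : A ⟶ X), q ≫ g = (a.eqv X).symm (r ≫ s ≫ a.eqv X g) := by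
    intro X g
    dsimp only [q]
    rw [← a.nat_symm, Category.assoc, Category.assoc, ← a.nat, Category.id_comp]
  obtain ⟨B, i, p, hip, hpi⟩ := IsIdempotentComplete.idempotents_split A q (by
    rw [hq]; dsimp only [q]; simp [reassoc_of% hsr])
  have hqp : q ≫ p = p := by rw [← hpi, Category.assoc, hip, Category.comp_id]
  refine ⟨B, ⟨⟨fun X => ⟨fun f => s ≫ a.eqv X (p ≫ f), fun g => i ≫ (a.eqv X).symm (r ≫ g),
    ?_, ?_⟩, ?_⟩⟩⟩
  · intro f
    dsimp only
    rw [← hq, reassoc_of% hqp, reassoc_of% hip]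
  · intro g
    dsimp only
    rw [reassoc_of% hpi, hq]
    simp [reassoc_of% hsr]
  · intro X X' h u
    simp only [Equiv.coe_fn_mk, Category.assoc]
    rw [← a.nat, Category.assoc]

lemma exists_right (H : ∀ Y, ∃ A, Nonempty (RRep F Y A)) {Y : D} {A : C} (a : RRep F Y A) :
    ∃ R : D ⥤ C, Nonempty (F ⊣ R) ∧ Nonempty (R.obj Y ≅ A) := by
  choose G hG using H
  let b : ∀ Y, RRep F Y (G Y) := fun Y => (hG Y).some
  exact ⟨Adjunction.rightAdjointOfEquiv (fun X Y => (b Y).eqv X)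
    (fun X' X Y f g => (b Y).nat f g), ⟨Adjunction.adjunctionOfEquivRight _ _⟩,
    ⟨(b Y).iso a⟩⟩

lemma exists_left (H : ∀ Y, ∃ A, Nonempty (LRep F Y A)) {Y : D} {A : C} (a : LRep F Y A) :
    ∃ L : D ⥤ C, Nonempty (L ⊣ F) ∧ Nonempty (L.obj Y ≅ A) := by
  choose G hG using H
  let b : ∀ Y, LRep F Y (G Y) := fun Y => (hG Y).some
  exact ⟨Adjunction.leftAdjointOfEquiv (fun Y X => (b Y).eqv X)
    (fun Y X X' f g => (b Y).nat f g), ⟨Adjunction.adjunctionOfEquivLeft _ _⟩,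
    ⟨(b Y).iso a⟩⟩

end Rep

section Mon

variable {C : Type u₁} {D : Type u₂} [Category.{v₁} C] [Category.{v₂} D]
  [MonoidalCategory C] [MonoidalCategory D] (F : C ⥤ D) [F.Monoidal]

/-- Monoidal functors preserve exact pairings. -/
@[reducible] def mapPairing (X Y : C) [ExactPairing X Y] :
    ExactPairing (F.obj X) (F.obj Y) where
  coevaluation' := ε F ≫ F.map (η_ X Y) ≫ δ F X Y
  evaluation' := μ F Y X ≫ F.map (ε_ X Y) ≫ η F
  coevaluation_evaluation' := by
    have h := congrArg F.map (ExactPairing.coevaluation_evaluation X Y)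
    simp only [Functor.map_comp, Functor.Monoidal.map_whiskerLeft,
      Functor.Monoidal.map_whiskerRight, Functor.Monoidal.map_associator_inv,
      Functor.Monoidal.map_rightUnitor, Functor.Monoidal.map_leftUnitor_inv] at h
    simp only [Category.assoc, Functor.Monoidal.μ_δ_assoc] at h
    rw [← cancel_epi (δ F Y (𝟙_ C) ≫ F.obj Y ◁ η F),
      ← cancel_mono (ε F ▷ F.obj Y ≫ μ F (𝟙_ C) Y)]
    simp only [MonoidalCategory.whiskerLeft_comp, comp_whiskerRight, Category.assoc]
    refine Eq.trans ?_ h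
    simp
  evaluation_coevaluation' := by
    have h := congrArg F.map (ExactPairing.evaluation_coevaluation X Y)
    simp only [Functor.map_comp, Functor.Monoidal.map_whiskerLeft,
      Functor.Monoidal.map_whiskerRight, Functor.Monoidal.map_associator,
      Functor.Monoidal.map_leftUnitor, Functor.Monoidal.map_rightUnitor_inv] at h
    simp only [Category.assoc, Functor.Monoidal.μ_δ_assoc] at h
    rw [← cancel_epi (δ F (𝟙_ C) X ≫ η F ▷ F.obj X),
      ← cancel_mono (F.obj X ◁ ε F ≫ μ F X (𝟙_ C))]
    simp only [MonoidalCategory.whiskerLeft_comp, comp_whiskerRight, Category.assoc]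
    refine Eq.trans ?_ h
    simp

/-- The canonical map `Hom(W, Z ⊗ X) → Hom(F W, F X)`. -/
def psi {Z : C} (z : F.obj Z ⟶ 𝟙_ D) (W X : C) (g : W ⟶ Z ⊗ X) : F.obj W ⟶ F.obj X :=
  F.map g ≫ δ F Z X ≫ z ▷ F.obj X ≫ (λ_ _).hom

lemma psi_left {Z : C} (z : F.obj Z ⟶ 𝟙_ D) {W W' X : C} (h : W ⟶ W') (g : W' ⟶ Z ⊗ X) :
    psi F z W X (h ≫ g) = F.map h ≫ psi F z W' X g := by
  simp [psi]

lemma psi_right {Z : C} (z : F.obj Z ⟶ 𝟙_ D) {W X X' : C} (h : X ⟶ X') (g : W ⟶ Z ⊗ X) :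
    psi F z W X' (g ≫ Z ◁ h) = psi F z W X g ≫ F.map h := by
  simp only [psi, Functor.map_comp, Category.assoc, Functor.Monoidal.map_whiskerLeft,
    Functor.Monoidal.μ_δ_assoc]
  rw [whisker_exchange_assoc, leftUnitor_naturality]

lemma psi_eq {Z : C} (z : F.obj Z ⟶ 𝟙_ D) (W X' X : C) [ExactPairing X' X]
    (g : W ⟶ Z ⊗ X) :
    letI := mapPairing F X' X
    (tensorRightHomEquiv (F.obj W) (F.obj X') (F.obj X) (𝟙_ D)).symm
        (psi F z W X g ≫ (λ_ _).inv) =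
      μ F W X' ≫ F.map ((tensorRightHomEquiv W X' X Z).symm g) ≫ z := by
  let _ := mapPairing F X' X
  change _ ▷ _ ≫ _ ≫ _ ◁ (μ F X X' ≫ F.map (ε_ X' X) ≫ η F) ≫ _ =
    _ ≫ F.map (_ ▷ _ ≫ _ ≫ _ ◁ _ ≫ _) ≫ _
  simp only [psi, Functor.map_comp, Functor.Monoidal.map_whiskerLeft,
    Functor.Monoidal.map_whiskerRight, Functor.Monoidal.map_associator,
    Functor.Monoidal.map_rightUnitor, Category.assoc, Functor.Monoidal.μ_δ_assoc,
    MonoidalCategory.whiskerLeft_comp, comp_whiskerRight]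
  rw [hom_inv_whiskerRight_assoc, ← rightUnitor_naturality, whisker_exchange_assoc,
    whisker_exchange_assoc, whisker_exchange_assoc, associator_naturality_left_assoc]

lemma psi_bij {Z : C} (a : RRep F (𝟙_ D) Z) (W X : C) [HasLeftDual X] :
    Function.Bijective (psi F ((a.eqv Z).symm (𝟙 Z)) W X) := by
  let _ := mapPairing F (ᘁX) X
  let T : (F.obj W ⟶ F.obj X) ≃ (F.obj W ⊗ F.obj (ᘁX) ⟶ 𝟙_ D) :=
    (Iso.homToEquiv (λ_ (F.obj X)).symm).trans
      (tensorRightHomEquiv (F.obj W) (F.obj (ᘁX)) (F.obj X) (𝟙_ D)).symm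
  let U : (W ⟶ Z ⊗ X) ≃ (F.obj W ⊗ F.obj (ᘁX) ⟶ 𝟙_ D) :=
    ((tensorRightHomEquiv W (ᘁX) X Z).symm.trans (a.eqv _).symm).trans
      (Iso.homFromEquiv (Functor.Monoidal.μIso F W (ᘁX)).symm)
  have h : ⇑T ∘ psi F ((a.eqv Z).symm (𝟙 Z)) W X = U := by
    funext g
    have := psi_eq F ((a.eqv Z).symm (𝟙 Z)) W (ᘁX) X g
    rw [← a.nat_symm, Category.comp_id] at this
    exact this
  have := U.bijective
  rw [← h] at this
  exact (Function.Bijective.of_comp_iff' T.bijective _).1 this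

/-- `Hom(F W, F X) ≃ Hom(W, Z ⊗ X)` -/
noncomputable def rrepObj {Z : C} (a : RRep F (𝟙_ D) Z) (X : C) [HasLeftDual X] :
    RRep F (F.obj X) (Z ⊗ X) where
  eqv W := (Equiv.ofBijective _ (psi_bij F a W X)).symm
  nat h u := by
    rw [Equiv.symm_apply_eq]
    refine Eq.trans ?_ (psi_left F _ _ _).symm
    congr 1
    exact ((Equiv.ofBijective _ (psi_bij F a _ X)).apply_symm_apply u).symm

noncomputable def lrepObj [LeftRigidCategory C] {Z : C} [HasRightDual Z]
    (a : RRep F (𝟙_ D) Z) (W : C) :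
    LRep F (F.obj W) (Zᘁ ⊗ W) where
  eqv X := (tensorLeftHomEquiv W Z (Zᘁ) X).trans (Equiv.ofBijective _ (psi_bij F a W X))
  nat h u := by
    simp only [Equiv.trans_apply, tensorLeftHomEquiv_naturality, Equiv.ofBijective_apply,
      psi_right]

def LRep.congr {Y Y' : D} {A A' : C} {F : C ⥤ D} (a : LRep F Y A) (i : Y' ≅ Y) (j : A' ≅ A) :
    LRep F Y' A' where
  eqv X := ((Iso.homFromEquiv j).trans (a.eqv X)).trans (Iso.homFromEquiv i.symm)
  nat h u := by
    simp [Iso.homFromEquiv, ← a.nat]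

end Mon

end AdjDominant

open CategoryTheory CategoryTheory.MonoidalCategory CategoryTheory.Limits

/-- Let `F : C ⥤ D` be a `k`-linear monoidal functor between `k`-linear additive rigid
monoidal categories such that (1) `Hom_D(F(-), 𝟙)` is representable by `Z : C`,
(2) `F` is dominant (every object of `D` is a direct summand of some `F X`), and
(3) `C` is idempotent complete. Then `F` has a right adjoint `R` with `R 𝟙 ≅ Z` and a
left adjoint `L` with `L 𝟙 ≅ Zᘁ` (the paper's `Z^*`). -/
theorem adjoints_of_representable_dominant {k : Type*} [Field k]
    {C D : Type*} [Category C] [Category D]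
    [Preadditive C] [Preadditive D] [Linear k C] [Linear k D]
    [HasFiniteBiproducts C] [HasFiniteBiproducts D]
    [MonoidalCategory C] [MonoidalCategory D] [RigidCategory C] [RigidCategory D]
    (F : C ⥤ D) [F.Monoidal] [F.Additive] [F.Linear k]
    (Z : C)
    (e : ∀ X : C, (F.obj X ⟶ 𝟙_ D) ≃ (X ⟶ Z))
    (he : ∀ {X X' : C} (h : X ⟶ X') (u : F.obj X' ⟶ 𝟙_ D),
      e X (F.map h ≫ u) = h ≫ e X' u)
    (hdom : ∀ Y : D, ∃ (X : C) (s : Y ⟶ F.obj X) (r : F.obj X ⟶ Y), s ≫ r = 𝟙 Y)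
    [IsIdempotentComplete C] :
    (∃ R : D ⥤ C, Nonempty (F ⊣ R) ∧ Nonempty (R.obj (𝟙_ D) ≅ Z)) ∧
    (∃ L : D ⥤ C, Nonempty (L ⊣ F) ∧ Nonempty (L.obj (𝟙_ D) ≅ (Zᘁ : C))) := by
  let a : AdjDominant.RRep F (𝟙_ D) Z := ⟨e, he⟩
  refine ⟨AdjDominant.exists_right (fun Y => ?_) a, AdjDominant.exists_left (fun Y => ?_)
    ((AdjDominant.lrepObj F a (𝟙_ C)).congr (Functor.Monoidal.εIso F) (ρ_ _).symm)⟩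
  · obtain ⟨X, s, r, h⟩ := hdom Y
    exact (AdjDominant.rrepObj F a X).retract s r h
  · obtain ⟨X, s, r, h⟩ := hdom Y
    exact (AdjDominant.lrepObj F a X).retract s r h
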